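/- arXiv:2011.13003 — 3 statements merged into one kernel-verified Lean document; each statement's English description precedes it below -/
import Mathlib

section
/- Let C, (D_i)_{i∈I} be Krull-Schmidt categories and Φ_i : C → D_i linear functors such that for any finite collection X_1,…,X_n of pairwise non-isomorphic indecomposable objects of C, there exists i ∈ I with Φ_i(X_1),…,Φ_i(X_n) indecomposable and pairwise non-isomorphic, and with the induced maps End_C(X_j) → End_{D_i}(Φ_i(X_j)) local. Then a bounded-above cochain complex C• over C is null-homotopic if and only if Φ_i(C•) is null-homotopic for every i ∈ I. -/
open CategoryTheory CategoryTheory.Limits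

/-- A (preadditive) category is Krull–Schmidt if every object is a finite direct sum of
objects having local endomorphism rings. -/
def IsKrullSchmidt (C : Type*) [Category C] [Preadditive C] [HasFiniteBiproducts C] : Prop :=
  ∀ X : C, ∃ (n : ℕ) (f : Fin n → C),
    Nonempty (X ≅ ⨁ f) ∧ ∀ j, IsLocalRing (End (f j))

/-- A cochain complex is null-homotopic if its identity is homotopic to zero. -/
def NullHomotopic {C : Type*} [Category C] [Preadditive C]
    (X : CochainComplex C ℤ) : Prop :=
  Nonempty (Homotopy (𝟙 X) 0)

namespace AdaptedFamily

/-- A finite family of objects has a finite list of representatives up to isomorphism. -/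
theorem exists_representatives {C : Type*} [Category C] {n : ℕ} (f : Fin n → C) :
    ∃ (m : ℕ) (g : Fin m → Fin n), (∀ j, ∃ k, Nonempty (f j ≅ f (g k))) ∧
      ∀ k l, k ≠ l → ¬ Nonempty (f (g k) ≅ f (g l)) := by
  classical
  let S : Setoid (Fin n) :=
    { r := fun a b => Nonempty (f a ≅ f b)
      iseqv := ⟨fun _ => ⟨Iso.refl _⟩, fun ⟨φ⟩ => ⟨φ.symm⟩, fun ⟨φ⟩ ⟨ψ⟩ => ⟨φ ≪≫ ψ⟩⟩ }
  let E := Fintype.equivFin (Quotient S)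
  refine ⟨_, fun k => (E.symm k).out, fun j => ⟨E (Quotient.mk S j), ?_⟩, fun k l hkl h => hkl ?_⟩
  · simp only [Equiv.symm_apply_apply]
    exact Setoid.symm (Quotient.mk_out (s := S) j)
  · exact E.symm.injective (Quotient.out_equiv_out.1 h)

section LocalEnd

variable {C : Type*} [Category C] [Preadditive C]

theorem exists_isIso_of_sum_eq_id {X : C} [IsLocalRing (End X)] {ι : Type*} [Fintype ι]
    (u : ι → (X ⟶ X)) (h : ∑ j, u j = 𝟙 X) : ∃ j, IsIso (u j) := by
  let v : ι → End X := u
  have hv : ∑ j, v j = 1 := h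
  obtain ⟨j, -, hj⟩ := IsLocalRing.exists_of_isUnit_sum (hv ▸ isUnit_one)
  exact ⟨j, (isUnit_iff_isIso _).1 hj⟩

theorem eq_zero_or_eq_id_of_idempotent {X : C} [IsLocalRing (End X)] (e : X ⟶ X)
    (he : e ≫ e = e) : e = 0 ∨ e = 𝟙 X := by
  obtain ⟨j, hj⟩ := exists_isIso_of_sum_eq_id ![e, 𝟙 X - e] (by simp)
  fin_cases j
  · have : IsIso e := hj
    right
    rw [← cancel_mono e, he, Category.id_comp]
  · have : IsIso (𝟙 X - e) := hj
    left
    rw [← cancel_mono (𝟙 X - e)]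
    simp [he]

theorem id_ne_zero_of_isLocalRing_end (X : C) [IsLocalRing (End X)] : 𝟙 X ≠ 0 :=
  fun h => one_ne_zero (α := End X) h

theorem isLocalRing_end_of_iso {X Y : C} (φ : X ≅ Y) (h : IsLocalRing (End X)) :
    IsLocalRing (End Y) := by
  have : Nontrivial (End Y) := ⟨1, 0, fun h0 => id_ne_zero_of_isLocalRing_end X (by
    rw [← φ.hom_inv_id, ← Category.id_comp φ.inv, show 𝟙 Y = 0 from h0, zero_comp, comp_zero])⟩
  refine ⟨fun {a b} hab => ?_⟩
  have h1 : φ.symm.conj a + φ.symm.conj b = 1 := by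
    calc φ.symm.conj a + φ.symm.conj b = φ.hom ≫ ((a : Y ⟶ Y) + (b : Y ⟶ Y)) ≫ φ.inv := by
          rw [Preadditive.add_comp, Preadditive.comp_add]; rfl
      _ = φ.symm.conj (a + b) := rfl
      _ = 1 := by rw [hab, map_one]
  simpa using IsLocalRing.isUnit_or_isUnit_of_add_one h1

theorem indecomposable_of_isLocalRing_end [HasBinaryBiproducts C] (X : C)
    [IsLocalRing (End X)] : Indecomposable X := by
  refine ⟨fun h => id_ne_zero_of_isLocalRing_end X (h.eq_of_src _ _), fun Y Z φ => ?_⟩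
  rcases eq_zero_or_eq_id_of_idempotent (φ.hom ≫ biprod.fst ≫ biprod.inl ≫ φ.inv)
    (by simp) with h | h
  · left
    rw [IsZero.iff_id_eq_zero]
    calc 𝟙 Y = biprod.inl ≫ φ.inv ≫ (φ.hom ≫ biprod.fst ≫ biprod.inl ≫ φ.inv) ≫
          φ.hom ≫ biprod.fst := by simp
      _ = 0 := by rw [h]; simp
  · right
    rw [IsZero.iff_id_eq_zero]
    calc 𝟙 Z = biprod.inr ≫ φ.inv ≫ 𝟙 X ≫ φ.hom ≫ biprod.snd := by simp
      _ = 0 := by rw [← h]; simp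

theorem isIso_of_section_of_isLocalRing_end {X Y : C} [IsLocalRing (End X)]
    [IsLocalRing (End Y)] (g : X ⟶ Y) (s : Y ⟶ X) (h : s ≫ g = 𝟙 Y) : IsIso g := by
  rcases eq_zero_or_eq_id_of_idempotent (g ≫ s) (by simp [reassoc_of% h]) with h0 | h1
  · exact absurd (calc 𝟙 Y = s ≫ (g ≫ s) ≫ g := by simp [h]
      _ = 0 := by rw [h0]; simp) (id_ne_zero_of_isLocalRing_end Y)
  · exact ⟨s, h1, h⟩

/-- Splitting the first summand off a finite biproduct. -/
noncomputable def biproductFinSuccIso [HasFiniteBiproducts C] [HasBinaryBiproducts C] {n : ℕ}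
    (f : Fin (n + 1) → C) : ⨁ f ≅ f 0 ⊞ ⨁ (fun j : Fin n => f j.succ) where
  hom := biprod.lift (biproduct.π f 0) (biproduct.lift fun j => biproduct.π f j.succ)
  inv := biproduct.lift (Fin.cases biprod.fst fun j => biprod.snd ≫ biproduct.π _ j)
  hom_inv_id := by
    apply biproduct.hom_ext
    intro j
    refine Fin.cases ?_ (fun j => ?_) j <;> simp
  inv_hom_id := by
    apply biprod.hom_ext
    · simp
    · apply biproduct.hom_ext
      intro j
      simp

theorem isLocalRing_end_of_indecomposable [HasFiniteBiproducts C] [HasBinaryBiproducts C]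
    (hC : IsKrullSchmidt C) {X : C} (hX : Indecomposable X) : IsLocalRing (End X) := by
  obtain ⟨n, f, ⟨φ⟩, hf⟩ := hC X
  cases n with
  | zero =>
    refine absurd ?_ hX.1
    rw [IsZero.iff_id_eq_zero, ← cancel_mono φ.hom]
    apply biproduct.hom_ext
    exact fun j => j.elim0
  | succ n =>
    rcases hX.2 _ _ (φ ≪≫ biproductFinSuccIso f) with h | h
    · have := hf 0
      exact absurd (h.eq_of_src _ _) (id_ne_zero_of_isLocalRing_end (f 0))
    · refine isLocalRing_end_of_iso (φ ≪≫ biproductFinSuccIso f ≪≫ ?_).symm (hf 0)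
      exact ⟨biprod.fst, biprod.inl, by
        apply biprod.hom_ext
        · simp
        · exact h.eq_of_tgt _ _, by simp⟩

/-- Every object of a Krull–Schmidt category carries a finite orthogonal decomposition of the
identity through objects with local endomorphism rings. -/
theorem exists_decomposition [HasFiniteBiproducts C] (hC : IsKrullSchmidt C) (X : C) :
    ∃ (n : ℕ) (f : Fin n → C) (p : ∀ j, X ⟶ f j) (q : ∀ j, f j ⟶ X),
      (∀ j, IsLocalRing (End (f j))) ∧ (∀ j, q j ≫ p j = 𝟙 _) ∧
      (∀ j k, j ≠ k → q j ≫ p k = 0) ∧ ∑ j, p j ≫ q j = 𝟙 X := by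
  obtain ⟨n, f, ⟨φ⟩, hf⟩ := hC X
  refine ⟨n, f, fun j => φ.hom ≫ biproduct.π f j, fun j => biproduct.ι f j ≫ φ.inv, hf,
    fun j => by simp, fun j k h => by simp [biproduct.ι_π_ne f h], ?_⟩
  have : ∑ j, biproduct.π f j ≫ biproduct.ι f j = 𝟙 (⨁ f) := biproduct.total
  calc _ = φ.hom ≫ (∑ j, biproduct.π f j ≫ biproduct.ι f j) ≫ φ.inv := by
        simp only [Preadditive.sum_comp, Preadditive.comp_sum, Category.assoc]
    _ = 𝟙 X := by rw [this]; simp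

end LocalEnd

section Family

variable {C : Type*} [Category C] [Preadditive C]
  {I : Type*} {D : I → Type*} [∀ i, Category (D i)] [∀ i, Preadditive (D i)]
  (Φ : ∀ i, C ⥤ D i)

/-- A morphism `d` into the source of the idempotent `e` is split onto `e` as soon as this holds
after applying every functor of the family. -/
def ReflectsSplitting {B : C} (e : B ⟶ B) : Prop :=
  ∀ (A : C) (d : A ⟶ B),
    (∀ i, ∃ t, t ≫ (Φ i).map (d ≫ e) = (Φ i).map e) → ∃ s, s ≫ d ≫ e = e

theorem ReflectsSplitting.zero [∀ i, (Φ i).Additive] (B : C) :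
    ReflectsSplitting Φ (0 : B ⟶ B) :=
  fun _ _ _ => ⟨0, by simp⟩

variable {Φ}

theorem ReflectsSplitting.add [∀ i, (Φ i).Additive] {B : C} {e f : B ⟶ B}
    (he : ReflectsSplitting Φ e) (hf : ReflectsSplitting Φ f) (hee : e ≫ e = e)
    (hff : f ≫ f = f) (hef : e ≫ f = 0) (hfe : f ≫ e = 0) : ReflectsSplitting Φ (e + f) := by
  intro A d hd
  obtain ⟨s, hs⟩ := he A d fun i => by
    obtain ⟨t, ht⟩ := hd i
    refine ⟨(Φ i).map e ≫ t, ?_⟩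
    have h1 := congr((Φ i).map e ≫ $ht ≫ (Φ i).map e)
    simpa [← Functor.map_comp, hee, hef, hfe] using h1
  obtain ⟨u, hu⟩ := hf A (d - d ≫ e ≫ s ≫ d) fun i => by
    obtain ⟨t, ht⟩ := hd i
    refine ⟨(Φ i).map f ≫ t, ?_⟩
    have h1 := congr((Φ i).map f ≫ $ht ≫ (Φ i).map f)
    have h2 := congr((Φ i).map f ≫ $ht ≫ (Φ i).map (e ≫ s ≫ d ≫ f))
    have e2 : (e + f) ≫ e ≫ s ≫ d ≫ f = e ≫ s ≫ d ≫ f := by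
      simp [reassoc_of% hee, reassoc_of% hfe]
    have e3 : (e + f) ≫ f = f := by simp [hef, hff]
    have e4 : f ≫ e ≫ s ≫ d ≫ f = 0 := by simp [reassoc_of% hfe]
    simp only [Category.assoc, ← Functor.map_comp, e2, e3, e4, hff, Functor.map_zero] at h1 h2
    simp only [Category.assoc, Preadditive.sub_comp, Functor.map_sub, Preadditive.comp_sub, h1, h2,
      sub_zero]
  let w := f ≫ u ≫ (𝟙 A - d ≫ e ≫ s)
  have hwe : w ≫ d ≫ e = 0 := by simp [w, hs, hee]
  have hwf : w ≫ d ≫ f = f := by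
    calc w ≫ d ≫ f = f ≫ u ≫ (d - d ≫ e ≫ s ≫ d) ≫ f := by simp [w]
      _ = f := by rw [hu, hff]
  refine ⟨e ≫ s - e ≫ s ≫ d ≫ f ≫ w + w, ?_⟩
  simp [hs, hee, hwe, hwf, hff]

theorem ReflectsSplitting.exists_lift [HasBinaryBiproducts C] [∀ i, (Φ i).Additive] {B : C}
    (hB : ReflectsSplitting Φ (𝟙 B)) {A : C} (d : A ⟶ B) (e : B ⟶ B) (hde : d ≫ e = d)
    (hee : e ≫ e = e) (h : ∀ i, ∃ t, t ≫ (Φ i).map d = (Φ i).map e) : ∃ s, s ≫ d = e := by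
  obtain ⟨s, hs⟩ := hB (A ⊞ B) (biprod.desc d (𝟙 B - e)) fun i => by
    obtain ⟨t, ht⟩ := h i
    refine ⟨t ≫ (Φ i).map biprod.inl + (Φ i).map biprod.inr, ?_⟩
    simp [← Functor.map_comp, ht]
  refine ⟨s ≫ biprod.fst, ?_⟩
  have h1 := congr($hs ≫ e)
  have h2 : biprod.desc d (𝟙 B - e) ≫ e = biprod.fst ≫ d := by
    apply biprod.hom_ext' <;> simp [hde, hee]
  simpa [h2] using h1

variable (Φ) in
/-- Every finite collection of pairwise non-isomorphic indecomposables admits an index whose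
functor keeps them indecomposable and pairwise non-isomorphic, and reflects isomorphisms among
their endomorphisms. -/
def IsAdapted [HasBinaryBiproducts C] [∀ i, HasBinaryBiproducts (D i)] : Prop :=
  ∀ (n : ℕ) (X : Fin n → C),
    (∀ j, Indecomposable (X j)) →
    (∀ j k, j ≠ k → ¬ Nonempty (X j ≅ X k)) →
    ∃ i : I, (∀ j, Indecomposable ((Φ i).obj (X j))) ∧
      (∀ j k, j ≠ k → ¬ Nonempty ((Φ i).obj (X j) ≅ (Φ i).obj (X k))) ∧
      (∀ j (e : End (X j)), IsIso ((Φ i).map e) → IsIso e)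

theorem exists_adapted_index [HasBinaryBiproducts C]
    [∀ i, HasFiniteBiproducts (D i)] [∀ i, HasBinaryBiproducts (D i)]
    (hD : ∀ i, IsKrullSchmidt (D i))
    (hadapted : IsAdapted Φ)
    {n : ℕ} (f : Fin n → C) (hf : ∀ j, IsLocalRing (End (f j))) :
    ∃ i, (∀ j, IsLocalRing (End ((Φ i).obj (f j)))) ∧
      ∀ (j k) (u : f j ⟶ f k), IsIso ((Φ i).map u) → IsIso u := by
  obtain ⟨m, g, hg, hgne⟩ := exists_representatives f
  obtain ⟨i, h1, h2, h3⟩ := hadapted m (fun k => f (g k))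
    (fun k => indecomposable_of_isLocalRing_end _) hgne
  refine ⟨i, fun j => ?_, fun j k u hu => ?_⟩
  · obtain ⟨k, ⟨φ⟩⟩ := hg j
    exact isLocalRing_end_of_iso ((Φ i).mapIso φ).symm
      (isLocalRing_end_of_indecomposable (hD i) (h1 k))
  · obtain ⟨a, ⟨α⟩⟩ := hg j
    obtain ⟨b, ⟨β⟩⟩ := hg k
    obtain rfl : a = b := by
      by_contra hab
      exact h2 a b hab
        ⟨((Φ i).mapIso α).symm ≪≫ asIso ((Φ i).map u) ≪≫ (Φ i).mapIso β⟩
    have h4 : IsIso (α.inv ≫ u ≫ β.hom) := h3 a _ (by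
      rw [Functor.map_comp, Functor.map_comp]
      infer_instance)
    have h5 : u = α.hom ≫ (α.inv ≫ u ≫ β.hom) ≫ β.inv := by simp
    rw [h5]
    infer_instance

theorem exists_section_of_isLocalRing_end [HasFiniteBiproducts C] [HasBinaryBiproducts C]
    [∀ i, HasFiniteBiproducts (D i)] [∀ i, HasBinaryBiproducts (D i)]
    (hC : IsKrullSchmidt C) (hD : ∀ i, IsKrullSchmidt (D i)) [∀ i, (Φ i).Additive]
    (hadapted : IsAdapted Φ)
    {A Y : C} (hY : IsLocalRing (End Y)) (d : A ⟶ Y)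
    (h : ∀ i, ∃ t, t ≫ (Φ i).map d = 𝟙 _) : ∃ s, s ≫ d = 𝟙 Y := by
  obtain ⟨n, f, p, q, hf, -, -, hsum⟩ := exists_decomposition hC A
  obtain ⟨i, h1, h2⟩ := exists_adapted_index hD hadapted (Fin.cons Y f : Fin (n + 1) → C)
    (Fin.cases hY hf)
  have hΦY : IsLocalRing (End ((Φ i).obj Y)) := h1 0
  have hΦf : ∀ j : Fin n, IsLocalRing (End ((Φ i).obj (f j))) := fun j => h1 j.succ
  obtain ⟨t, ht⟩ := h i
  have hd : ∑ j, p j ≫ q j ≫ d = d := by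
    simpa [Preadditive.sum_comp] using congr($hsum ≫ d)
  obtain ⟨j, hj⟩ := exists_isIso_of_sum_eq_id
    (fun j => t ≫ (Φ i).map (p j) ≫ (Φ i).map (q j ≫ d)) (by
      rw [← ht]
      conv_rhs => rw [← hd]
      simp [Functor.map_sum, Preadditive.comp_sum])
  have hj' : IsIso ((t ≫ (Φ i).map (p j)) ≫ (Φ i).map (q j ≫ d)) := by
    rwa [Category.assoc]
  have := isIso_of_section_of_isLocalRing_end ((Φ i).map (q j ≫ d))
    (inv ((t ≫ (Φ i).map (p j)) ≫ (Φ i).map (q j ≫ d)) ≫ t ≫ (Φ i).map (p j))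
    (by rw [Category.assoc]; exact IsIso.inv_hom_id _)
  have hiso : IsIso (q j ≫ d) := h2 j.succ 0 (q j ≫ d) this
  exact ⟨inv (q j ≫ d) ≫ q j, by simp⟩

theorem reflectsSplitting_id [HasFiniteBiproducts C] [HasBinaryBiproducts C]
    [∀ i, HasFiniteBiproducts (D i)] [∀ i, HasBinaryBiproducts (D i)]
    (hC : IsKrullSchmidt C) (hD : ∀ i, IsKrullSchmidt (D i)) [∀ i, (Φ i).Additive]
    (hadapted : IsAdapted Φ)
    (B : C) : ReflectsSplitting Φ (𝟙 B) := by
  classical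
  obtain ⟨n, f, p, q, hf, hqp, hqp0, hsum⟩ := exists_decomposition hC B
  rw [← hsum]
  have hqp' : ∀ j {Z : C} (g : f j ⟶ Z), q j ≫ p j ≫ g = g := fun j Z g => by
    rw [← Category.assoc, hqp, Category.id_comp]
  have hqp0' : ∀ j k, j ≠ k → ∀ {Z : C} (g : f k ⟶ Z), q j ≫ p k ≫ g = 0 :=
    fun j k hjk Z g => by rw [← Category.assoc, hqp0 j k hjk, zero_comp]
  suffices ∀ S : Finset (Fin n), (∑ j ∈ S, p j ≫ q j) ≫ (∑ j ∈ S, p j ≫ q j) =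
      ∑ j ∈ S, p j ≫ q j ∧ ReflectsSplitting Φ (∑ j ∈ S, p j ≫ q j) from
    (this Finset.univ).2
  intro S
  induction S using Finset.induction_on with
  | empty => simpa using ReflectsSplitting.zero Φ B
  | insert a S ha ih =>
    have hne : ∀ j ∈ S, a ≠ j := fun j hj h => ha (h ▸ hj)
    have h1 : (p a ≫ q a) ≫ p a ≫ q a = p a ≫ q a := by simp [hqp']
    have h2 : (p a ≫ q a) ≫ (∑ j ∈ S, p j ≫ q j) = 0 := by
      rw [Preadditive.comp_sum]
      exact Finset.sum_eq_zero fun j hj => by simp [hqp0' a j (hne j hj)]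
    have h3 : (∑ j ∈ S, p j ≫ q j) ≫ p a ≫ q a = 0 := by
      rw [Preadditive.sum_comp]
      exact Finset.sum_eq_zero fun j hj => by simp [hqp0' j a (hne j hj).symm]
    rw [Finset.sum_insert ha]
    refine ⟨by rw [Preadditive.add_comp, Preadditive.comp_add, Preadditive.comp_add, h1, h2, h3,
      ih.1, add_zero, zero_add], ReflectsSplitting.add ?_ ih.2 h1 ih.1 h2 h3⟩
    intro A d hd
    obtain ⟨s, hs⟩ := exists_section_of_isLocalRing_end hC hD hadapted (hf a) (d ≫ p a)
      fun i => by
        obtain ⟨t, ht⟩ := hd i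
        refine ⟨(Φ i).map (q a) ≫ t, ?_⟩
        have := congr((Φ i).map (q a) ≫ $ht ≫ (Φ i).map (p a))
        simp only [Category.assoc, ← Functor.map_comp, hqp, Category.comp_id] at this
        rw [Category.assoc, this, CategoryTheory.Functor.map_id]
    exact ⟨p a ≫ s, by simp [reassoc_of% hs]⟩

end Family

section Contraction

variable {C : Type*} [Category C] [Preadditive C] (X : CochainComplex C ℤ)

open Classical in
/-- One step of the descending construction of a contracting homotopy. -/
noncomputable def contractionStep (i j : ℤ) (h : X.X (i + 1) ⟶ X.X i) : X.X i ⟶ X.X j :=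
  if hs : ∃ s : X.X i ⟶ X.X j, s ≫ X.d j i = 𝟙 _ - X.d i (i + 1) ≫ h then hs.choose else 0

/-- Iterating `contractionStep` downwards, starting from zero. -/
noncomputable def contractionAux : ℕ → ∀ i j : ℤ, X.X i ⟶ X.X j
  | 0 => fun _ _ => 0
  | k + 1 => fun i j => contractionStep X i j (contractionAux k (i + 1) i)

/-- A bounded-above complex is null-homotopic once partial contractions extend downwards. -/
theorem nullHomotopic_of_extension {b : ℤ} (hb : ∀ r, b < r → IsZero (X.X r))
    (hX : ∀ (j i k : ℤ) (_ : j + 1 = i) (_ : i + 1 = k) (h : X.X k ⟶ X.X i),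
      X.d i k ≫ h ≫ X.d i k = X.d i k → ∃ s : X.X i ⟶ X.X j, s ≫ X.d j i = 𝟙 _ - X.d i k ≫ h) :
    NullHomotopic X := by
  let H : ∀ i j : ℤ, X.X i ⟶ X.X j := fun i j => contractionAux X (b + 1 - i).toNat i j
  have key : ∀ (n : ℕ) (i j : ℤ), (b + 1 - i).toNat = n → j + 1 = i →
      H i j ≫ X.d j i = 𝟙 _ - X.d i (i + 1) ≫ H (i + 1) i := by
    intro n
    induction n with
    | zero => exact fun i j hn hj => (hb i (by omega)).eq_of_src _ _
    | succ n ih =>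
      intro i j hn hj
      have hn' : (b + 1 - (i + 1)).toNat = n := by omega
      have hH : H i j = contractionStep X i j (H (i + 1) i) := by
        simp only [H, hn, hn', contractionAux]
      have hex := hX j i (i + 1) hj rfl (H (i + 1) i) (by simp [ih (i + 1) i hn' rfl])
      rw [hH, contractionStep, dif_pos hex]
      exact hex.choose_spec
  refine ⟨{ hom := fun i j => if j + 1 = i then H i j else 0
            zero := fun i j hij => if_neg hij
            comm := fun i => ?_ }⟩
  rw [dNext_eq _ (show (ComplexShape.up ℤ).Rel i (i + 1) from rfl),
    prevD_eq _ (show (ComplexShape.up ℤ).Rel (i - 1) i from sub_add_cancel i 1)]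
  simp [key _ i (i - 1) rfl (sub_add_cancel i 1)]

end Contraction

end AdaptedFamily

/-- Let `C, (D i)_{i ∈ I}` be Krull–Schmidt categories and
`Φ i : C ⥤ D i` linear functors such that every finite collection of pairwise
non-isomorphic indecomposables of `C` admits an adapted index `i` (images
indecomposable and pairwise non-isomorphic, induced endomorphism ring maps local).
Then a bounded-above cochain complex over `C` is null-homotopic iff its image under
every `Φ i` is null-homotopic. -/
theorem boundedAbove_nullHomotopic_iff_of_adapted_family
    {K : Type*} [Field K]
    {C : Type*} [Category C] [Preadditive C] [Linear K C]
    [HasFiniteBiproducts C] [HasBinaryBiproducts C]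
    {I : Type*} {D : I → Type*} [∀ i, Category (D i)] [∀ i, Preadditive (D i)]
    [∀ i, Linear K (D i)] [∀ i, HasFiniteBiproducts (D i)] [∀ i, HasBinaryBiproducts (D i)]
    (hC : IsKrullSchmidt C) (hD : ∀ i, IsKrullSchmidt (D i))
    (Φ : ∀ i, C ⥤ D i) [∀ i, (Φ i).Additive] [∀ i, (Φ i).Linear K]
    (hadapted : ∀ (n : ℕ) (X : Fin n → C),
      (∀ j, Indecomposable (X j)) →
      (∀ j k, j ≠ k → ¬ Nonempty (X j ≅ X k)) →
      ∃ i : I, (∀ j, Indecomposable ((Φ i).obj (X j))) ∧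
        (∀ j k, j ≠ k → ¬ Nonempty ((Φ i).obj (X j) ≅ (Φ i).obj (X k))) ∧
        (∀ j (e : End (X j)), IsIso ((Φ i).map e) → IsIso e))
    (Kc : CochainComplex C ℤ)
    (hbdd : ∃ b : ℤ, ∀ r : ℤ, b < r → IsZero (Kc.X r)) :
    NullHomotopic Kc ↔
      ∀ i : I, NullHomotopic
        (((Φ i).mapHomologicalComplex (ComplexShape.up ℤ)).obj Kc) := by
  refine ⟨fun ⟨h⟩ i => ⟨(Homotopy.ofEq (((Φ i).mapHomologicalComplex _).map_id Kc).symm).trans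
    (((Φ i).mapHomotopy h).trans (Homotopy.ofEq (Functor.map_zero _ _ _)))⟩, fun h => ?_⟩
  obtain ⟨b, hb⟩ := hbdd
  refine AdaptedFamily.nullHomotopic_of_extension Kc hb fun j i k hj hk g hg => ?_
  refine (AdaptedFamily.reflectsSplitting_id hC hD hadapted (Kc.X i)).exists_lift _ _
    (by simp) (by simp [reassoc_of% hg]) fun a => ?_
  obtain ⟨H⟩ := h a
  have hH := H.comm i
  rw [dNext_eq _ (show (ComplexShape.up ℤ).Rel i k from hk),
    prevD_eq _ (show (ComplexShape.up ℤ).Rel j i from hj)] at hH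
  let u : (Φ a).obj (Kc.X i) ⟶ (Φ a).obj (Kc.X j) := H.hom i j
  let v : (Φ a).obj (Kc.X k) ⟶ (Φ a).obj (Kc.X i) := H.hom k i
  refine ⟨(Φ a).map (𝟙 _ - Kc.d i k ≫ g) ≫ u, ?_⟩
  have h0 : (𝟙 _ - Kc.d i k ≫ g) ≫ Kc.d i k = 0 := by simp [hg]
  have h1 : 𝟙 ((Φ a).obj (Kc.X i)) =
      (Φ a).map (Kc.d i k) ≫ v + u ≫ (Φ a).map (Kc.d j i) :=
    hH.trans (add_zero _)
  have h2 := congr((Φ a).map (𝟙 _ - Kc.d i k ≫ g) ≫ $h1)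
  rw [Preadditive.comp_add, ← Functor.map_comp_assoc, h0, Functor.map_zero, zero_comp, zero_add,
    Category.comp_id] at h2
  rw [Category.assoc, ← h2]
end

section
/- In the affine nil Hecke algebra H_{k+1}, the element e_n' := (−1)^{k(k+1)/2} τ_{ω_0} x_1^k x_2^{k-1} ⋯ x_k (with n = k+1, ω_0 the longest element) and e_n := x_2 x_3² ⋯ x_{k+1}^k τ_{ω_0} are idempotents, and moreover e_n · e_n' = 0 when n ≥ 2. -/
open MvPolynomial

/-- Generators of the affine nil Hecke algebra `H_n`: `x i` for `i : Fin n` and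
`t k` for `k : Fin (n-1)` (so `t k` corresponds to `τ_{k+1}` in one-based notation). -/
inductive NHGen (n : ℕ) : Type
  | x : Fin n → NHGen n
  | t : Fin (n - 1) → NHGen n

namespace NHGen

/-- The image in `Fin n` of the smaller index of `t k`. -/
def lo {n : ℕ} (k : Fin (n - 1)) : Fin n := ⟨k.val, by have := k.isLt; omega⟩
/-- The image in `Fin n` of the larger index of `t k`. -/
def hi {n : ℕ} (k : Fin (n - 1)) : Fin n := ⟨k.val + 1, by have := k.isLt; omega⟩

end NHGen

/-- The defining relations of the affine nil Hecke algebra. -/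
inductive NHRel (K : Type) [Field K] (n : ℕ) :
    FreeAlgebra K (NHGen n) → FreeAlgebra K (NHGen n) → Prop
  | xx (i j : Fin n) : NHRel K n
      (FreeAlgebra.ι K (NHGen.x i) * FreeAlgebra.ι K (NHGen.x j))
      (FreeAlgebra.ι K (NHGen.x j) * FreeAlgebra.ι K (NHGen.x i))
  | tsq (k : Fin (n - 1)) : NHRel K n
      (FreeAlgebra.ι K (NHGen.t k) * FreeAlgebra.ι K (NHGen.t k)) 0
  | tx (k : Fin (n - 1)) (i : Fin n) : NHRel K n
      (FreeAlgebra.ι K (NHGen.t k) * FreeAlgebra.ι K (NHGen.x i) -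
        FreeAlgebra.ι K (NHGen.x (Equiv.swap (NHGen.lo k) (NHGen.hi k) i)) *
          FreeAlgebra.ι K (NHGen.t k))
      ((if i = NHGen.hi k then 1 else 0) - (if i = NHGen.lo k then 1 else 0))
  | tt (k l : Fin (n - 1)) (h : k.val + 1 < l.val) : NHRel K n
      (FreeAlgebra.ι K (NHGen.t k) * FreeAlgebra.ι K (NHGen.t l))
      (FreeAlgebra.ι K (NHGen.t l) * FreeAlgebra.ι K (NHGen.t k))
  | braid (k l : Fin (n - 1)) (h : l.val = k.val + 1) : NHRel K n
      (FreeAlgebra.ι K (NHGen.t l) * FreeAlgebra.ι K (NHGen.t k) * FreeAlgebra.ι K (NHGen.t l))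
      (FreeAlgebra.ι K (NHGen.t k) * FreeAlgebra.ι K (NHGen.t l) * FreeAlgebra.ι K (NHGen.t k))

/-- The affine nil Hecke algebra `H_n` over `K`, presented by generators and relations. -/
def NilHecke (K : Type) [Field K] (n : ℕ) : Type := RingQuot (NHRel K n)

noncomputable instance (K : Type) [Field K] (n : ℕ) : Ring (NilHecke K n) :=
  inferInstanceAs (Ring (RingQuot (NHRel K n)))

noncomputable instance (K : Type) [Field K] (n : ℕ) : Algebra K (NilHecke K n) :=
  inferInstanceAs (Algebra K (RingQuot (NHRel K n)))

/-- The generator `x_{i+1}` of `H_n` (zero-based index `i`). -/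
noncomputable def xgen {K : Type} [Field K] {n : ℕ} (i : Fin n) : NilHecke K n :=
  RingQuot.mkAlgHom K (NHRel K n) (FreeAlgebra.ι K (NHGen.x i))

/-- The generator `τ_{k+1}` of `H_n` (zero-based index `k`). -/
noncomputable def tgen {K : Type} [Field K] {n : ℕ} (k : Fin (n - 1)) : NilHecke K n :=
  RingQuot.mkAlgHom K (NHRel K n) (FreeAlgebra.ι K (NHGen.t k))

open NHGen in
/-- The product of the simple transpositions along a word `L`. -/
def wordProd {n : ℕ} (L : List (Fin (n - 1))) : Equiv.Perm (Fin n) :=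
  (L.map (fun k => Equiv.swap (lo k) (hi k))).prod

/-- The number of inversions of a permutation, i.e. its Coxeter length. -/
def invCount {n : ℕ} (σ : Equiv.Perm (Fin n)) : ℕ :=
  (Finset.univ.filter (fun p : Fin n × Fin n => p.1 < p.2 ∧ σ p.2 < σ p.1)).card

/-- The product `τ_{i_1} ⋯ τ_{i_r}` in `H_n` along a word `L = [i_1, …, i_r]`. -/
noncomputable def tauProd {K : Type} [Field K] {n : ℕ} (L : List (Fin (n - 1))) :
    NilHecke K n :=
  (L.map tgen).prod

/-- A family `t 0, …, t (m - 1)`, `x 0, …, x m` in a ring satisfying the relations of the affine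
nil Hecke algebra `H_{m+1}`. -/
structure IsNilHeckeFamily {A : Type*} [Ring A] (m : ℕ) (t x : ℕ → A) : Prop where
  xx : ∀ i ≤ m, ∀ j ≤ m, Commute (x i) (x j)
  tsq : ∀ k < m, t k * t k = 0
  tt : ∀ k l, k + 1 < l → l < m → Commute (t k) (t l)
  braid : ∀ k, k + 1 < m → t (k + 1) * t k * t (k + 1) = t k * t (k + 1) * t k
  tx_hi : ∀ k < m, t k * x (k + 1) = x k * t k + 1
  tx_lo : ∀ k < m, t k * x k = x (k + 1) * t k - 1
  tx_far : ∀ k < m, ∀ i ≤ m, i ≠ k → i ≠ k + 1 → Commute (t k) (x i)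

/-- The ascending product `t b * t (b + 1) * ⋯ * t (b + a - 1)`. -/
def ascProd {A : Type*} [Monoid A] (t : ℕ → A) : ℕ → ℕ → A
  | _, 0 => 1
  | b, a + 1 => t b * ascProd t (b + 1) a

/-- The product of `t` along the staircase reduced word of the longest element of `S_{r+1}`. -/
def longestProd {A : Type*} [Monoid A] (t : ℕ → A) : ℕ → A
  | 0 => 1
  | r + 1 => ascProd t 0 (r + 1) * longestProd t r

/-- `IsNormalProd t r l y` says that `y` is a product of `t` along a word of length `l` in the
first `r` letters that is in normal form. -/
inductive IsNormalProd {A : Type*} [Monoid A] (t : ℕ → A) : ℕ → ℕ → A → Prop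
  | one : IsNormalProd t 0 0 1
  | mul {r l b a : ℕ} {y : A} (hy : IsNormalProd t r l y) (h : b + a = r + 1) :
      IsNormalProd t (r + 1) (l + a) (ascProd t b a * y)

section Monoid

variable {A : Type*} [Monoid A] (t : ℕ → A)

theorem ascProd_succ_right (b a : ℕ) : ascProd t b (a + 1) = ascProd t b a * t (b + a) := by
  induction a generalizing b with
  | zero => simp [ascProd]
  | succ a ih =>
    rw [ascProd, ih, ascProd, mul_assoc, add_right_comm, add_assoc]

theorem IsNormalProd.one' (r : ℕ) : IsNormalProd t r 0 1 := by
  induction r with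
  | zero => exact .one
  | succ r ih => simpa [ascProd] using ih.mul (b := r + 1) (a := 0) rfl

variable {t}

theorem IsNormalProd.length_le {r l : ℕ} {y : A} (h : IsNormalProd t r l y) :
    2 * l ≤ r * (r + 1) := by
  induction h with
  | one => simp
  | mul _ h ih => nlinarith

theorem IsNormalProd.eq_longestProd {r l : ℕ} {y : A} (h : IsNormalProd t r l y)
    (hl : 2 * l = r * (r + 1)) : y = longestProd t r := by
  induction h with
  | one => rfl
  | @mul r l b a y hy h ih =>
    have := hy.length_le
    obtain rfl : b = 0 := by nlinarith
    obtain rfl : a = r + 1 := by omega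
    rw [longestProd, ih (by nlinarith)]

end Monoid

namespace IsNilHeckeFamily

variable {A : Type*} [Ring A] {m : ℕ} {t x : ℕ → A}

/-- The diagram automorphism, which negates each `x i`. -/
theorem reverse (h : IsNilHeckeFamily m t x) :
    IsNilHeckeFamily m (fun k => t (m - 1 - k)) (fun i => -x (m - i)) where
  xx i _ j _ := ((h.xx _ (by omega) _ (by omega)).neg_left).neg_right
  tsq k hk := h.tsq _ (by omega)
  tt k l hkl hl := (h.tt _ _ (by omega) (by omega)).symm
  braid k hk := by
    have := h.braid (m - 1 - (k + 1)) (by omega)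
    rw [show m - 1 - (k + 1) + 1 = m - 1 - k by omega] at this
    exact this.symm
  tx_hi k hk := by
    have := h.tx_lo (m - 1 - k) (by omega)
    rw [show m - 1 - k + 1 = m - k by omega] at this
    rw [show m - (k + 1) = m - 1 - k by omega, mul_neg, this]
    noncomm_ring
  tx_lo k hk := by
    have := h.tx_hi (m - 1 - k) (by omega)
    rw [show m - 1 - k + 1 = m - k by omega] at this
    rw [show m - (k + 1) = m - 1 - k by omega, mul_neg, this]
    noncomm_ring
  tx_far k hk i hi h₁ h₂ := (h.tx_far _ (by omega) _ (by omega) (by omega) (by omega)).neg_right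

theorem commute_ascProd (h : IsNilHeckeFamily m t x) {k b a : ℕ} (hk : k + 1 < b)
    (hb : b + a ≤ m) : Commute (t k) (ascProd t b a) := by
  induction a generalizing b with
  | zero => exact Commute.one_right _
  | succ a ih =>
    exact (h.tt k b hk (by omega)).mul_right (ih (by omega) (by omega))

theorem mul_ascProd (h : IsNilHeckeFamily m t x) {k b a : ℕ} (hk : b ≤ k)
    (hka : k + 1 < b + a) (hb : b + a ≤ m) :
    t (k + 1) * ascProd t b a = ascProd t b a * t k := by
  induction a generalizing b with
  | zero => omega
  | succ a ih =>
    obtain rfl | hlt := hk.eq_or_lt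
    · obtain ⟨a, rfl⟩ : ∃ c, a = c + 1 := ⟨a - 1, by omega⟩
      have hc := h.commute_ascProd (k := b) (b := b + 1 + 1) (a := a) (by omega) (by omega)
      simp only [ascProd]
      rw [← mul_assoc, ← mul_assoc, h.braid b (by omega), mul_assoc, hc.eq]
      simp only [mul_assoc]
    · rw [ascProd, ← mul_assoc, ← (h.tt b (k + 1) (by omega) (by omega)).eq, mul_assoc,
        ih hlt (by omega) (by omega), mul_assoc]

theorem mul_isNormalProd (h : IsNilHeckeFamily m t x) {r l k : ℕ} {y : A}
    (hy : IsNormalProd t r l y) (hr : r ≤ m) (hk : k < r) :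
    t k * y = 0 ∨ IsNormalProd t r (l + 1) (t k * y) := by
  induction hy generalizing k with
  | one => omega
  | @mul r l b a y hy hba ih =>
    have push : ∀ j < r, t k * ascProd t b a = ascProd t b a * t j →
        t k * (ascProd t b a * y) = 0 ∨
          IsNormalProd t (r + 1) (l + a + 1) (t k * (ascProd t b a * y)) := by
      intro j hj hc
      rw [← mul_assoc, hc, mul_assoc]
      refine (ih (by omega) hj).imp (fun h0 => by rw [h0, mul_zero]) fun hn => ?_
      rw [add_right_comm]
      exact hn.mul hba
    rcases lt_trichotomy (k + 1) b with hlt | rfl | hgt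
    · exact push k (by omega) (h.commute_ascProd hlt (by omega)).eq
    · right
      rw [← mul_assoc]
      exact hy.mul (b := k) (a := a + 1) (by omega)
    · obtain rfl | hlt := (Nat.lt_succ_iff.mp hgt).eq_or_lt
      · left
        obtain ⟨a, rfl⟩ : ∃ c, a = c + 1 := ⟨a - 1, by omega⟩
        rw [ascProd, ← mul_assoc, ← mul_assoc, h.tsq b (by omega), zero_mul, zero_mul]
      · obtain ⟨k, rfl⟩ : ∃ c, k = c + 1 := ⟨k - 1, by omega⟩
        exact push k (by omega) (h.mul_ascProd (by omega) (by omega) (by omega))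

theorem prod_eq_zero_or_isNormalProd (h : IsNilHeckeFamily m t x) (L : List ℕ)
    (hL : ∀ k ∈ L, k < m) :
    (L.map t).prod = 0 ∨ IsNormalProd t m L.length (L.map t).prod := by
  induction L with
  | nil => exact .inr (.one' t m)
  | cons k L ih =>
    rw [List.map_cons, List.prod_cons, List.length_cons]
    rcases ih fun j hj => hL j (List.mem_cons_of_mem _ hj) with h0 | hn
    · exact .inl (by rw [h0, mul_zero])
    · exact h.mul_isNormalProd hn le_rfl (hL k List.mem_cons_self)

theorem prod_eq_zero (h : IsNilHeckeFamily m t x) (L : List ℕ) (hL : ∀ k ∈ L, k < m)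
    (hlen : m * (m + 1) < 2 * L.length) : (L.map t).prod = 0 :=
  (h.prod_eq_zero_or_isNormalProd L hL).resolve_right fun hn => hn.length_le.not_gt hlen

theorem mul_pow_mul (h : IsNilHeckeFamily m t x) {k : ℕ} (hk : k < m) {v : A}
    (hv : t k * v = 0) (p : ℕ) :
    t k * (x (k + 1) ^ p * v) =
      ∑ i ∈ Finset.range p, x k ^ i * (x (k + 1) ^ (p - 1 - i) * v) := by
  induction p with
  | zero => simp [hv]
  | succ p ih =>
    rw [Finset.sum_range_succ', pow_succ', mul_assoc, ← mul_assoc (t k), h.tx_hi k hk, add_mul,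
      mul_assoc, ih, Finset.mul_sum]
    congr 1
    · refine Finset.sum_congr rfl fun i _ => ?_
      rw [← mul_assoc, ← pow_succ', show p + 1 - 1 - (i + 1) = p - 1 - i by omega]
    · simp

theorem mul_pow_mul_eq_zero (h : IsNilHeckeFamily m t x) {k i : ℕ} (hki : k + 1 < i)
    (hi : i ≤ m) {v : A} (hv : t k * v = 0) (p : ℕ) : t k * (x i ^ p * v) = 0 := by
  rw [← mul_assoc, ((h.tx_far k (by omega) i hi (by omega) (by omega)).pow_right p).eq, mul_assoc,
    hv, mul_zero]

theorem ascProd_mul_pow_mul (h : IsNilHeckeFamily m t x) {r p : ℕ} (hr : r ≤ m) (hp : p ≤ r)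
    {v : A} (hv : ∀ k < r, t k * v = 0) :
    ascProd t 0 r * (x r ^ p * v) = if p = r then v else 0 := by
  induction r generalizing p v with
  | zero =>
    obtain rfl : p = 0 := by omega
    simp [ascProd]
  | succ r ih =>
    have key : ∀ i ∈ Finset.range p,
        ascProd t 0 r * (x r ^ i * (x (r + 1) ^ (p - 1 - i) * v)) =
          if i = r then v else 0 := by
      intro i hi
      rw [Finset.mem_range] at hi
      rw [ih (by omega) (by omega) fun k hk =>
        h.mul_pow_mul_eq_zero (by omega) hr (hv k (by omega)) _]
      split_ifs with hir
      · rw [show p - 1 - i = 0 by omega, pow_zero, one_mul]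
      · rfl
    rw [ascProd_succ_right, zero_add, mul_assoc, h.mul_pow_mul (by omega) (hv r (by omega)),
      Finset.mul_sum, Finset.sum_congr rfl key, Finset.sum_ite_eq']
    simp only [Finset.mem_range]
    exact if_congr (by omega) rfl rfl

theorem longestProd_mul_prod_mul (h : IsNilHeckeFamily m t x) {r : ℕ} (hr : r ≤ m) {v : A}
    (hv : ∀ k < r, t k * v = 0) :
    longestProd t r * (((List.range (r + 1)).map fun j => x j ^ j).prod * v) = v := by
  induction r generalizing v with
  | zero => simp [longestProd]
  | succ r ih =>
    rw [List.range_succ, List.map_append, List.prod_append, longestProd, mul_assoc, mul_assoc,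
      List.map_singleton, List.prod_singleton,
      ih (by omega) fun k hk => h.mul_pow_mul_eq_zero (by omega) hr (hv k (by omega)) _,
      h.ascProd_mul_pow_mul hr le_rfl hv, if_pos rfl]

theorem prod_mul_prod_mul_prod (h : IsNilHeckeFamily m t x) (L : List ℕ) (hL : ∀ k ∈ L, k < m)
    (hlen : 2 * L.length = m * (m + 1)) :
    (L.map t).prod * (((List.range (m + 1)).map fun j => x j ^ j).prod * (L.map t).prod) =
      (L.map t).prod := by
  rcases h.prod_eq_zero_or_isNormalProd L hL with h0 | hn
  · simp [h0]
  · have hv : ∀ k < m, t k * (L.map t).prod = 0 := fun k hk => by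
      rw [← List.prod_cons, ← List.map_cons]
      refine h.prod_eq_zero (k :: L) (by simpa using ⟨hk, hL⟩) ?_
      rw [List.length_cons]
      omega
    conv_lhs => enter [1]; rw [hn.eq_longestProd hlen]
    exact h.longestProd_mul_prod_mul le_rfl hv

theorem prod_mul_prod_reverse_mul_prod (h : IsNilHeckeFamily m t x) (L : List ℕ)
    (hL : ∀ k ∈ L, k < m) (hlen : 2 * L.length = m * (m + 1)) :
    (L.map t).prod * (((-1) ^ L.length * ((List.range (m + 1)).map fun j => x j ^ (m - j)).prod) *
      (L.map t).prod) = (L.map t).prod := by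
  have hsign : ∀ (y : ℕ → A) (n : ℕ), ((List.range n).map fun j => (-y j) ^ j).prod =
      (-1) ^ (∑ j ∈ Finset.range n, j) * ((List.range n).map fun j => y j ^ j).prod := by
    intro y n
    induction n with
    | zero => simp
    | succ n ih =>
      simp only [List.range_succ, List.map_append, List.prod_append, List.map_singleton,
        List.prod_singleton, Finset.sum_range_succ]
      rw [ih, neg_pow (y n), pow_add]
      simp only [mul_assoc]
      rw [← mul_assoc (List.prod _) ((-1) ^ n), ((Commute.neg_one_right _).pow_right n).eq, mul_assoc]
  have hsum : ∑ j ∈ Finset.range (m + 1), j = L.length := by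
    have := Finset.sum_range_id_mul_two (m + 1)
    rw [Nat.add_sub_cancel] at this
    linarith
  have hperm : ((List.range (m + 1)).map fun j => x j ^ (m - j)).prod =
      ((List.range (m + 1)).map fun j => x (m - j) ^ j).prod := by
    have hrev : ((List.range (m + 1)).map fun j => x (m - j) ^ j) =
        ((List.range (m + 1)).map fun j => x j ^ (m - j)).reverse := by
      refine List.ext_getElem (by simp) fun i h₁ _ => ?_
      simp only [List.length_map, List.length_range] at h₁
      simp [show m - (m - i) = i by omega]
    rw [hrev]
    refine (List.reverse_perm _).symm.prod_eq' (List.pairwise_of_forall_mem_list ?_)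
    simp only [List.mem_map, List.mem_range]
    rintro _ ⟨i, hi, rfl⟩ _ ⟨j, hj, rfl⟩
    exact (h.xx i (by omega) j (by omega)).pow_pow _ _
  have hL' : (L.map fun k => m - 1 - k).map (fun k => t (m - 1 - k)) = L.map t := by
    rw [List.map_map]
    refine List.map_congr_left fun k hk => ?_
    have := hL k hk
    simp [show m - 1 - (m - 1 - k) = k by omega]
  have := h.reverse.prod_mul_prod_mul_prod (L.map fun k => m - 1 - k)
    (by simp only [List.mem_map]; rintro _ ⟨k, hk, rfl⟩; have := hL k hk; omega) (by simpa using hlen)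
  rwa [hL', hsign, hsum, ← hperm] at this

end IsNilHeckeFamily

theorem tgen_mul_xgen {K : Type} [Field K] {n : ℕ} (k : Fin (n - 1)) (i : Fin n) :
    (tgen k : NilHecke K n) * xgen i - xgen (Equiv.swap (NHGen.lo k) (NHGen.hi k) i) * tgen k =
      (if i = NHGen.hi k then 1 else 0) - (if i = NHGen.lo k then 1 else 0) := by
  have := RingQuot.mkAlgHom_rel K (NHRel.tx (K := K) k i)
  simp only [map_sub, map_mul, apply_ite (RingQuot.mkAlgHom K (NHRel K n)), map_one,
    map_zero] at this
  exact this

/-- The generators of `H_{m+1}`, indexed by natural numbers and extended by zero. -/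
theorem isNilHeckeFamily_gen (K : Type) [Field K] (m : ℕ) :
    IsNilHeckeFamily m
      (fun k => if h : k < m then (tgen ⟨k, h⟩ : NilHecke K (m + 1)) else 0)
      (fun i => if h : i < m + 1 then (xgen ⟨i, h⟩ : NilHecke K (m + 1)) else 0) where
  xx i hi j hj := by
    have := RingQuot.mkAlgHom_rel K (NHRel.xx (K := K) (n := m + 1) ⟨i, by omega⟩ ⟨j, by omega⟩)
    simp only [map_mul] at this
    simp only [Nat.lt_succ_of_le hi, Nat.lt_succ_of_le hj, dif_pos]
    exact this
  tsq k hk := by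
    have := RingQuot.mkAlgHom_rel K (NHRel.tsq (K := K) (n := m + 1) ⟨k, hk⟩)
    simp only [map_mul, map_zero] at this
    simp only [hk, dif_pos]
    exact this
  tt k l hkl hl := by
    have hk : k < m := by omega
    have := RingQuot.mkAlgHom_rel K (NHRel.tt (K := K) (n := m + 1) ⟨k, hk⟩ ⟨l, hl⟩ hkl)
    simp only [map_mul] at this
    simp only [hk, hl, dif_pos]
    exact this
  braid k hl := by
    have hk : k < m := by omega
    have := RingQuot.mkAlgHom_rel K (NHRel.braid (K := K) (n := m + 1) ⟨k, hk⟩ ⟨k + 1, hl⟩ rfl)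
    simp only [map_mul] at this
    simp only [hk, hl, dif_pos]
    exact this
  tx_hi k hk := by
    have := tgen_mul_xgen (K := K) (n := m + 1) ⟨k, hk⟩ (NHGen.hi ⟨k, hk⟩)
    rw [Equiv.swap_apply_right, if_pos rfl, if_neg (by simp [NHGen.lo, NHGen.hi]), sub_zero,
      sub_eq_iff_eq_add'] at this
    simp only [hk, Nat.lt_succ_of_lt hk, Nat.succ_lt_succ hk, dif_pos]
    exact this
  tx_lo k hk := by
    have := tgen_mul_xgen (K := K) (n := m + 1) ⟨k, hk⟩ (NHGen.lo ⟨k, hk⟩)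
    rw [Equiv.swap_apply_left, if_pos rfl, if_neg (by simp [NHGen.lo, NHGen.hi]), zero_sub,
      sub_eq_iff_eq_add', ← sub_eq_add_neg] at this
    simp only [hk, Nat.lt_succ_of_lt hk, Nat.succ_lt_succ hk, dif_pos]
    exact this
  tx_far k hk i hi h₁ h₂ := by
    have hlo : (⟨i, Nat.lt_succ_of_le hi⟩ : Fin (m + 1)) ≠ NHGen.lo ⟨k, hk⟩ := by
      simpa [NHGen.lo] using h₁
    have hhi : (⟨i, Nat.lt_succ_of_le hi⟩ : Fin (m + 1)) ≠ NHGen.hi ⟨k, hk⟩ := by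
      simpa [NHGen.hi] using h₂
    have := tgen_mul_xgen (K := K) (n := m + 1) ⟨k, hk⟩ ⟨i, Nat.lt_succ_of_le hi⟩
    rw [Equiv.swap_apply_of_ne_of_ne hlo hhi, if_neg hlo, if_neg hhi, sub_zero, sub_eq_zero] at this
    simp only [hk, Nat.lt_succ_of_le hi, dif_pos]
    exact this

/-- In the affine nil Hecke algebra `H_n`, the elements
`e_n' = (−1)^{n(n−1)/2} τ_{ω₀} x_1^{n-1} x_2^{n-2} ⋯ x_{n-1}` and
`e_n = x_2 x_3² ⋯ x_n^{n-1} τ_{ω₀}` are idempotents, and `e_n · e_n' = 0` when `n ≥ 2`.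
Here `τ_{ω₀}` is the product of `τ`'s along any reduced word `L₀` for the longest
element of `S_n` (length `n(n−1)/2`, number of inversions of the product equal to the
length). -/
theorem nilHecke_idempotents (K : Type) [Field K] (n : ℕ)
    (L₀ : List (Fin (n - 1)))
    (hL₀len : L₀.length = n * (n - 1) / 2)
    (hL₀red : invCount (wordProd L₀) = L₀.length) :
    IsIdempotentElem
      (((List.finRange n).map (fun j => (xgen j : NilHecke K n) ^ j.val)).prod *
        tauProd L₀) ∧
    IsIdempotentElem
      ((-1 : NilHecke K n) ^ (n * (n - 1) / 2) * (tauProd L₀ *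
        ((List.finRange n).map (fun j => (xgen j : NilHecke K n) ^ (n - 1 - j.val))).prod)) ∧
    (2 ≤ n →
      ((List.finRange n).map (fun j => (xgen j : NilHecke K n) ^ j.val)).prod * tauProd L₀ *
        ((-1 : NilHecke K n) ^ (n * (n - 1) / 2) * (tauProd L₀ *
          ((List.finRange n).map
            (fun j => (xgen j : NilHecke K n) ^ (n - 1 - j.val))).prod)) = 0) := by
  obtain _ | m := n
  · obtain rfl : L₀ = [] := List.eq_nil_iff_forall_not_mem.mpr fun k => k.elim0
    simp [tauProd, IsIdempotentElem]
  have h := isNilHeckeFamily_gen K m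
  have hmap : ((L₀.map Fin.val).map
      fun k => if h : k < m then (tgen ⟨k, h⟩ : NilHecke K (m + 1)) else 0).prod = tauProd L₀ := by
    rw [tauProd, List.map_map]
    refine congrArg List.prod (List.map_congr_left fun k _ => ?_)
    exact dif_pos k.isLt
  have hx : ∀ f : ℕ → ℕ, ((List.range (m + 1)).map fun j =>
      (if h : j < m + 1 then (xgen ⟨j, h⟩ : NilHecke K (m + 1)) else 0) ^ f j).prod =
      ((List.finRange (m + 1)).map fun j => (xgen j : NilHecke K (m + 1)) ^ f j.val).prod := by
    intro f
    rw [← List.map_coe_finRange_eq_range, List.map_map]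
    refine congrArg List.prod (List.map_congr_left fun j _ => ?_)
    exact congrArg (· ^ f j) (dif_pos j.isLt)
  have hlt : ∀ k ∈ L₀.map Fin.val, k < m := by
    simp only [List.mem_map]
    rintro _ ⟨k, _, rfl⟩
    exact k.isLt
  have hlen : 2 * L₀.length = m * (m + 1) := by
    rw [hL₀len, Nat.add_sub_cancel, mul_comm (m + 1),
      Nat.mul_div_cancel' (Nat.even_mul_succ_self m).two_dvd]
  have he := h.prod_mul_prod_mul_prod _ hlt (by simpa using hlen)
  have he' := h.prod_mul_prod_reverse_mul_prod _ hlt (by simpa using hlen)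
  rw [hmap, hx fun j => j] at he
  rw [hmap, hx fun j => m - j, List.length_map] at he'
  rw [← hL₀len]
  change _ ∧ IsIdempotentElem (_ * (_ * ((List.finRange (m + 1)).map
    fun j => (xgen j : NilHecke K (m + 1)) ^ (m - j.val)).prod)) ∧ _
  generalize ((List.finRange (m + 1)).map fun j => (xgen j : NilHecke K (m + 1)) ^ j.val).prod = X
    at he ⊢
  generalize ((List.finRange (m + 1)).map
    fun j => (xgen j : NilHecke K (m + 1)) ^ (m - j.val)).prod = Y at he' ⊢
  have hcomm : ∀ a : NilHecke K (m + 1), (-1) ^ L₀.length * a = a * (-1) ^ L₀.length :=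
    fun a => ((Commute.neg_one_left a).pow_left _).eq
  refine ⟨?_, ?_, fun hn => ?_⟩
  · rw [IsIdempotentElem, mul_assoc, he]
  · rw [IsIdempotentElem]
    calc _ = (-1) ^ L₀.length *
          ((tauProd L₀ * ((-1) ^ L₀.length * Y * tauProd L₀)) * Y) := by
          rw [hcomm Y]; simp only [mul_assoc]
      _ = _ := by rw [he']
  · have hsq : (tauProd L₀ : NilHecke K (m + 1)) * tauProd L₀ = 0 := by
      rw [← hmap, ← List.prod_append, ← List.map_append]
      refine h.prod_eq_zero _ (by simp) ?_
      simp only [List.length_append, List.length_map]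
      nlinarith
    rw [hcomm, mul_assoc, ← mul_assoc (tauProd L₀), ← mul_assoc (tauProd L₀), hsq]
    simp
end

section
/- Let n ∈ ℕ. The map P_n → H_n·e_n sending 1 to τ_{ω_0} is an isomorphism of (H_n, P_n^{S_n})-bimodules (up to a grading shift by n(n−1)/2), where e_n = x_2 x_3² ⋯ x_n^{n-1} τ_{ω_0} ∈ H_n, H_n acts on P_n via x_k ↦ multiplication and τ_k ↦ Demazure operator ∂_k, and P_n^{S_n} acts on both sides by right multiplication. -/
open MvPolynomial

/-! ### Rewriting words in the braid monoid -/

/-- Word reduction: delete a square, commute distant letters, or apply a braid move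
`(k+1) k (k+1) → k (k+1) k`, anywhere in the word. -/
inductive WordRed : List ℕ → List ℕ → Prop
  | refl (L : List ℕ) : WordRed L L
  | trans {L M N : List ℕ} : WordRed L M → WordRed M N → WordRed L N
  | sq (a b : List ℕ) (k : ℕ) : WordRed (a ++ k :: k :: b) (a ++ b)
  | comm (a b : List ℕ) (k l : ℕ) (h : k + 1 < l ∨ l + 1 < k) :
      WordRed (a ++ k :: l :: b) (a ++ l :: k :: b)
  | braid (a b : List ℕ) (k : ℕ) :
      WordRed (a ++ (k + 1) :: k :: (k + 1) :: b) (a ++ k :: (k + 1) :: k :: b)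

namespace WordRed

lemma append_left {L N : List ℕ} (h : WordRed L N) (c : List ℕ) : WordRed (c ++ L) (c ++ N) := by
  induction h with
  | refl L => exact refl _
  | trans _ _ h₁ h₂ => exact trans h₁ h₂
  | sq a b k => simpa using sq (c ++ a) b k
  | comm a b k l h => simpa using comm (c ++ a) b k l h
  | braid a b k => simpa using braid (c ++ a) b k

lemma append_right {L N : List ℕ} (h : WordRed L N) (c : List ℕ) : WordRed (L ++ c) (N ++ c) := by
  induction h with
  | refl L => exact refl _
  | trans _ _ h₁ h₂ => exact trans h₁ h₂
  | sq a b k => simpa using sq a (b ++ c) k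
  | comm a b k l h => simpa using comm a (b ++ c) k l h
  | braid a b k => simpa using braid a (b ++ c) k

lemma cons_comm (k : ℕ) (l : List ℕ) (h : ∀ x ∈ l, k + 1 < x ∨ x + 1 < k) :
    WordRed (k :: l) (l ++ [k]) := by
  induction l with
  | nil => exact refl _
  | cons x l ih =>
    exact trans (comm [] l k x (h x (by simp)))
      (append_left (ih fun y hy => h y (by simp [hy])) [x])

/-- Multiplying an ascending run ending in `m` by a letter gives such a run followed by a word in
smaller letters. -/
lemma cons_range' (m j k : ℕ) (hj : j ≤ m + 1) (hk : k ≤ m) :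
    ∃ i w, i ≤ m + 1 ∧ (∀ x ∈ w, x < m) ∧
      WordRed (k :: List.range' j (m + 1 - j)) (List.range' i (m + 1 - i) ++ w) := by
  rcases lt_trichotomy k j with hkj | rfl | hkj
  · rcases Nat.lt_or_ge (k + 1) j with h | h
    · refine ⟨j, [k], hj, by simp; omega, cons_comm _ _ fun x hx => ?_⟩
      rw [List.mem_range'_1] at hx
      omega
    · obtain rfl : j = k + 1 := by omega
      refine ⟨k, [], by omega, by simp, ?_⟩
      rw [show m + 1 - k = (m + 1 - (k + 1)) + 1 by omega, List.range'_succ]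
      simpa using refl _
  · refine ⟨k + 1, [], by omega, by simp, ?_⟩
    rw [show m + 1 - k = (m + 1 - (k + 1)) + 1 by omega, List.range'_succ]
    simpa using sq [] _ k
  · obtain ⟨d, rfl⟩ : ∃ d, k = j + d + 1 := ⟨k - j - 1, by omega⟩
    refine ⟨j, [j + d], hj, by simp; omega, ?_⟩
    have hsplit : List.range' j (m + 1 - j) = List.range' j d ++
        (j + d) :: (j + d + 1) :: List.range' (j + d + 2) (m + 1 - (j + d + 2)) := by
      rw [show m + 1 - j = d + (m + 1 - (j + d + 2) + 1 + 1) by omega,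
        ← List.range'_append_1, List.range'_succ, List.range'_succ]
    rw [hsplit]
    set R := List.range' (j + d + 2) (m + 1 - (j + d + 2)) with hR
    have h₁ : WordRed ((j + d + 1) :: (List.range' j d ++ (j + d) :: (j + d + 1) :: R))
        (List.range' j d ++ (j + d + 1) :: (j + d) :: (j + d + 1) :: R) := by
      simpa using append_right (cons_comm (j + d + 1) (List.range' j d) fun x hx => by
        rw [List.mem_range'_1] at hx; omega) ((j + d) :: (j + d + 1) :: R)
    have h₂ : WordRed (List.range' j d ++ (j + d) :: (j + d + 1) :: (j + d) :: R)
        (List.range' j d ++ (j + d) :: (j + d + 1) :: R ++ [j + d]) := by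
      simpa using append_left (cons_comm (j + d) R fun x hx => by
        rw [hR, List.mem_range'_1] at hx; omega) (List.range' j d ++ [j + d, j + d + 1])
    exact (h₁.trans (braid _ _ _)).trans h₂

end WordRed

/-- Normal forms of words in the letters `0, …, m - 1`. -/
inductive WordNF : ℕ → List ℕ → Prop
  | zero : WordNF 0 []
  | succ {m j : ℕ} {N : List ℕ} (hj : j ≤ m + 1) (hN : WordNF m N) :
      WordNF (m + 1) (List.range' j (m + 1 - j) ++ N)

/-- The longest normal form in the letters `0, …, m - 1`. -/
def maxWord : ℕ → List ℕ
  | 0 => []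
  | m + 1 => List.range' 0 (m + 1) ++ maxWord m

lemma length_maxWord (m : ℕ) : (maxWord m).length = (m + 1) * m / 2 := by
  have h : 2 * (maxWord m).length = (m + 1) * m := by
    induction m with
    | zero => rfl
    | succ m ih => simp only [maxWord, List.length_append, List.length_range']; linarith
  omega

lemma WordNF.length_le {m : ℕ} {N : List ℕ} (h : WordNF m N) :
    N.length ≤ (maxWord m).length := by
  induction h with
  | zero => simp
  | succ hj hN ih => simp [maxWord]; omega

lemma WordNF.eq_maxWord {m : ℕ} {N : List ℕ} (h : WordNF m N)
    (hlen : N.length = (maxWord m).length) : N = maxWord m := by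
  induction h with
  | zero => rfl
  | @succ m j N hj hN ih =>
    have := hN.length_le
    simp only [maxWord, List.length_append, List.length_range'] at hlen
    obtain rfl : j = 0 := by omega
    rw [ih (by omega)]
    rfl

lemma exists_wordNF (m : ℕ) (L : List ℕ) (hL : ∀ k ∈ L, k < m) :
    ∃ N, WordNF m N ∧ WordRed L N := by
  induction m generalizing L with
  | zero =>
    obtain rfl : L = [] := List.eq_nil_iff_forall_not_mem.2 fun k hk => by simpa using hL k hk
    exact ⟨[], .zero, .refl _⟩
  | succ m ih =>
    have key : ∃ j w, j ≤ m + 1 ∧ (∀ x ∈ w, x < m) ∧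
        WordRed L (List.range' j (m + 1 - j) ++ w) := by
      induction L with
      | nil => exact ⟨m + 1, [], le_rfl, by simp, by simpa using WordRed.refl _⟩
      | cons k L ihL =>
        obtain ⟨j, w, hj, hw, h⟩ := ihL fun x hx => hL x (by simp [hx])
        obtain ⟨i, v, hi, hv, h'⟩ := WordRed.cons_range' m j k hj
          (Nat.lt_succ_iff.1 (hL k (by simp)))
        refine ⟨i, v ++ w, hi, fun x hx => ?_, (h.append_left [k]).trans ?_⟩
        · rcases List.mem_append.1 hx with hx | hx
          exacts [hv x hx, hw x hx]
        · simpa using h'.append_right w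
    obtain ⟨j, w, hj, hw, h⟩ := key
    obtain ⟨N, hN, hwN⟩ := ih w hw
    exact ⟨_, .succ hj hN, h.trans (hwN.append_left _)⟩

/-! ### Interpreting words in `S_n` and in the nil Hecke algebra -/

namespace NilHecke

open NHGen

/-- The simple transposition with zero-based index `k` (trivial when out of range). -/
def swapNat (n k : ℕ) : Equiv.Perm (Fin n) :=
  if h : k < n - 1 then Equiv.swap (lo ⟨k, h⟩) (hi ⟨k, h⟩) else 1

/-- The generator `τ` of `H_n` with zero-based index `k` (zero when out of range). -/
noncomputable def tNat (K : Type) [Field K] (n k : ℕ) : NilHecke K n :=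
  if h : k < n - 1 then tgen ⟨k, h⟩ else 0

lemma swapNat_val {n : ℕ} (k : Fin (n - 1)) : swapNat n k = Equiv.swap (lo k) (hi k) := by
  simp [swapNat]

lemma tNat_val (K : Type) [Field K] {n : ℕ} (k : Fin (n - 1)) : tNat K n k = tgen k := by
  simp [tNat]

lemma wordProd_eq_map_val {n : ℕ} (L : List (Fin (n - 1))) :
    wordProd L = ((L.map Fin.val).map (swapNat n)).prod := by
  simp [wordProd, Function.comp_def, swapNat_val]

lemma tauProd_eq_map_val (K : Type) [Field K] {n : ℕ} (L : List (Fin (n - 1))) :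
    (tauProd L : NilHecke K n) = ((L.map Fin.val).map (tNat K n)).prod := by
  simp only [tauProd, List.map_map, Function.comp_def, tNat_val]

lemma swapNat_mul_self (n k : ℕ) : swapNat n k * swapNat n k = 1 := by
  unfold swapNat
  split_ifs <;> simp

lemma swapNat_comm (n : ℕ) {k l : ℕ} (h : k + 1 < l ∨ l + 1 < k) :
    swapNat n k * swapNat n l = swapNat n l * swapNat n k := by
  unfold swapNat
  split_ifs with hk hl hl <;> try simp only [one_mul, mul_one]
  refine Equiv.Perm.Disjoint.commute (fun i => ?_)
  simp only [Equiv.swap_apply_def, lo, hi, Fin.ext_iff]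
  grind

lemma swapNat_braid (n : ℕ) {k : ℕ} (hk : k + 1 < n - 1) :
    swapNat n (k + 1) * swapNat n k * swapNat n (k + 1) =
      swapNat n k * swapNat n (k + 1) * swapNat n k := by
  have hk' : k < n - 1 := by omega
  ext i : 1
  simp only [swapNat, hk, hk', dif_pos, Equiv.Perm.mul_apply, Equiv.swap_apply_def, lo, hi,
    Fin.ext_iff]
  grind

section Relations

variable {K : Type} [Field K] {n : ℕ}

lemma mk_rel {a b : FreeAlgebra K (NHGen n)} (h : NHRel K n a b) :
    (RingQuot.mkAlgHom K (NHRel K n) a : RingQuot (NHRel K n)) = RingQuot.mkAlgHom K _ b :=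
  RingQuot.mkAlgHom_rel K h

lemma tgen_mul_self (k : Fin (n - 1)) : (tgen k * tgen k : NilHecke K n) = 0 := by
  have h := mk_rel (NHRel.tsq (K := K) k)
  rw [map_mul, map_zero] at h
  exact h

lemma tgen_comm (k l : Fin (n - 1)) (hkl : k.val + 1 < l.val) :
    (tgen k * tgen l : NilHecke K n) = tgen l * tgen k := by
  have h := mk_rel (NHRel.tt (K := K) k l hkl)
  rw [map_mul, map_mul] at h
  exact h

lemma tgen_braid (k l : Fin (n - 1)) (hkl : l.val = k.val + 1) :
    (tgen l * tgen k * tgen l : NilHecke K n) = tgen k * tgen l * tgen k := by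
  have h := mk_rel (NHRel.braid (K := K) k l hkl)
  simp only [map_mul] at h
  exact h

lemma tgen_mul_xgen (k : Fin (n - 1)) (i : Fin n) :
    (tgen k * xgen i : NilHecke K n) = xgen (Equiv.swap (lo k) (hi k) i) * tgen k +
      ((if i = hi k then 1 else 0) - (if i = lo k then 1 else 0)) := by
  have h := mk_rel (NHRel.tx (K := K) k i)
  simp only [map_sub, map_mul, apply_ite (RingQuot.mkAlgHom K (NHRel K n)), map_one,
    map_zero] at h
  exact sub_eq_iff_eq_add'.1 h

lemma tNat_mul_self (k : ℕ) : tNat K n k * tNat K n k = 0 := by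
  unfold tNat
  split_ifs <;> simp [tgen_mul_self]

lemma tNat_comm {k l : ℕ} (h : k + 1 < l ∨ l + 1 < k) :
    tNat K n k * tNat K n l = tNat K n l * tNat K n k := by
  unfold tNat
  split_ifs with hk hl hl <;> try simp
  rcases h with h | h
  · exact tgen_comm _ _ h
  · exact (tgen_comm _ _ h).symm

lemma tNat_braid {k : ℕ} (hk : k + 1 < n - 1) :
    tNat K n (k + 1) * tNat K n k * tNat K n (k + 1) =
      tNat K n k * tNat K n (k + 1) * tNat K n k := by
  have hk' : k < n - 1 := by omega
  simp only [tNat, hk, hk', dif_pos]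
  exact tgen_braid _ _ rfl

end Relations

/-- A word reduction preserves the permutation, and it preserves the product of the `τ`'s unless
it shortens the word, in which case that product vanishes. -/
lemma WordRed.interpret (K : Type) [Field K] {n : ℕ} {L N : List ℕ} (h : WordRed L N)
    (hL : ∀ k ∈ L, k < n - 1) :
    (∀ k ∈ N, k < n - 1) ∧ (L.map (swapNat n)).prod = (N.map (swapNat n)).prod ∧
      (N.length = L.length ∧ (L.map (tNat K n)).prod = (N.map (tNat K n)).prod ∨
        N.length < L.length ∧ (L.map (tNat K n)).prod = 0) := by
  induction h with
  | refl L => exact ⟨hL, rfl, .inl ⟨rfl, rfl⟩⟩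
  | trans _ _ ih₁ ih₂ =>
    obtain ⟨hM, hs, ht⟩ := ih₁ hL
    obtain ⟨hN, hs', ht'⟩ := ih₂ hM
    refine ⟨hN, hs.trans hs', ?_⟩
    rcases ht with ⟨hl, ht⟩ | ⟨hl, ht⟩ <;> rcases ht' with ⟨hl', ht'⟩ | ⟨hl', ht'⟩
    · exact .inl ⟨hl'.trans hl, ht.trans ht'⟩
    · exact .inr ⟨by omega, ht.trans ht'⟩
    · exact .inr ⟨by omega, ht⟩
    · exact .inr ⟨by omega, ht⟩
  | sq a b k =>
    refine ⟨fun x hx => hL x (by simp at hx ⊢; tauto), ?_, .inr ⟨by simp, ?_⟩⟩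
    · simp [← mul_assoc (swapNat n k), swapNat_mul_self]
    · simp [← mul_assoc (tNat K n k), tNat_mul_self]
  | comm a b k l h =>
    refine ⟨fun x hx => hL x (by simp at hx ⊢; tauto), ?_, .inl ⟨by simp, ?_⟩⟩
    · simp [← mul_assoc (swapNat n _), swapNat_comm n h]
    · simp [← mul_assoc (tNat K n _), tNat_comm h]
  | braid a b k =>
    have hk : k + 1 < n - 1 := hL _ (by simp)
    refine ⟨fun x hx => hL x (by simp at hx ⊢; tauto), ?_, .inl ⟨by simp, ?_⟩⟩
    · simpa [mul_assoc] using
        congrArg (fun y => (a.map (swapNat n)).prod * (y * (b.map (swapNat n)).prod))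
          (swapNat_braid n hk)
    · simpa [mul_assoc] using
        congrArg (fun y => (a.map (tNat K n)).prod * (y * (b.map (tNat K n)).prod))
          (tNat_braid hk)

lemma invCount_swap_mul_le {n : ℕ} (k : Fin (n - 1)) (σ : Equiv.Perm (Fin n)) :
    invCount (Equiv.swap (lo k) (hi k) * σ) ≤ invCount σ + 1 := by
  unfold invCount
  refine (Finset.card_le_card fun p hp => ?_).trans
    (Finset.card_insert_le (σ⁻¹ (lo k), σ⁻¹ (hi k)) _)
  obtain ⟨a, b⟩ := p
  rw [Finset.mem_filter] at hp
  rw [Finset.mem_insert, Finset.mem_filter]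
  simp only [Finset.mem_univ, true_and, Equiv.Perm.mul_apply,
    Prod.mk.injEq, Equiv.Perm.eq_inv_iff_eq] at hp ⊢
  obtain ⟨hab, hp⟩ := hp
  have hne : σ a ≠ σ b := σ.injective.ne hab.ne
  simp only [Equiv.swap_apply_def, lo, hi, Fin.ext_iff, ne_eq] at hp hne ⊢
  simp only [Fin.lt_def] at hp ⊢
  grind

lemma invCount_one (n : ℕ) : invCount (1 : Equiv.Perm (Fin n)) = 0 := by
  rw [invCount, Finset.card_eq_zero, Finset.filter_eq_empty_iff]
  exact fun p _ h => lt_asymm h.1 h.2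

lemma invCount_le_length {n : ℕ} (L : List ℕ) :
    invCount (L.map (swapNat n)).prod ≤ L.length := by
  induction L with
  | nil => simp [invCount_one]
  | cons k L ih =>
    rw [List.map_cons, List.prod_cons, List.length_cons]
    unfold swapNat
    split_ifs with hk
    · exact (invCount_swap_mul_le _ _).trans (Nat.succ_le_succ ih)
    · rw [one_mul]
      exact ih.trans (Nat.le_succ _)

/-- Words longer than the longest permutation vanish in the nil Hecke algebra. -/
lemma prod_tNat_eq_zero (K : Type) [Field K] {n : ℕ} (L : List ℕ) (hL : ∀ k ∈ L, k < n - 1)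
    (hlen : (maxWord (n - 1)).length < L.length) : (L.map (tNat K n)).prod = 0 := by
  obtain ⟨N, hN, h⟩ := exists_wordNF (n - 1) L hL
  have hle := hN.length_le
  rcases (WordRed.interpret K h hL).2.2 with h | h
  · omega
  · exact h.2

/-- Every reduced word for the longest element gives the same element as `maxWord`. -/
lemma prod_tNat_eq_maxWord (K : Type) [Field K] {n : ℕ} (L : List ℕ) (hL : ∀ k ∈ L, k < n - 1)
    (hlen : L.length = (maxWord (n - 1)).length)
    (hred : invCount (L.map (swapNat n)).prod = L.length) :
    (L.map (tNat K n)).prod = ((maxWord (n - 1)).map (tNat K n)).prod := by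
  obtain ⟨N, hN, h⟩ := exists_wordNF (n - 1) L hL
  obtain ⟨-, hs, ht⟩ := WordRed.interpret K h hL
  have hle := invCount_le_length (n := n) N
  rcases ht with ⟨hl, ht⟩ | ⟨hl, -⟩
  · rw [ht, hN.eq_maxWord (hl.trans hlen)]
  · rw [← hs] at hle
    omega

/-! ### The polynomial representation -/

section Rep

variable {K : Type} [Field K] {n : ℕ}

lemma X_hi_sub_X_lo_ne_zero (k : Fin (n - 1)) :
    (X (hi k) - X (lo k) : MvPolynomial (Fin n) K) ≠ 0 := by
  rw [sub_ne_zero]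
  intro h
  have := X_injective h
  simp [hi, lo] at this

/-- Induction on the nil Hecke algebra through its generators. -/
lemma induction_gen {C : NilHecke K n → Prop} (h_scalar : ∀ r : K, C (algebraMap K _ r))
    (h_xgen : ∀ i, C (xgen i)) (h_tgen : ∀ k, C (tgen k))
    (h_sum : ∀ a b, C a → C b → C (a + b)) (h_prod : ∀ a b, C a → C b → C (a * b))
    (h : NilHecke K n) : C h := by
  obtain ⟨a, rfl⟩ := RingQuot.mkAlgHom_surjective K (NHRel K n) h
  induction a with
  | grade0 r => rw [AlgHom.commutes]; exact h_scalar r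
  | grade1 g =>
    cases g with
    | x i => exact h_xgen i
    | t k => exact h_tgen k
  | mul a b ha hb => rw [map_mul]; exact h_prod _ _ ha hb
  | add a b ha hb => rw [map_add]; exact h_sum _ _ ha hb

variable {ρ : NilHecke K n →ₐ[K] Module.End K (MvPolynomial (Fin n) K)}
  {ι : MvPolynomial (Fin n) K →ₐ[K] NilHecke K n}

/-- The twisted Leibniz rule for Demazure operators. -/
lemma rep_tgen_mul
    (hρt : ∀ (k : Fin (n - 1)) (P : MvPolynomial (Fin n) K),
      ρ (tgen k) P * (X (hi k) - X (lo k)) = P - rename (Equiv.swap (lo k) (hi k)) P)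
    (k : Fin (n - 1)) (f g : MvPolynomial (Fin n) K) :
    ρ (tgen k) (f * g) =
      rename (Equiv.swap (lo k) (hi k)) f * ρ (tgen k) g + ρ (tgen k) f * g := by
  refine mul_right_cancel₀ (X_hi_sub_X_lo_ne_zero k) ?_
  have h := hρt k (f * g)
  rw [map_mul (rename _)] at h
  linear_combination h - rename (Equiv.swap (lo k) (hi k)) f * hρt k g - g * hρt k f

lemma rep_tgen_eq_zero
    (hρt : ∀ (k : Fin (n - 1)) (P : MvPolynomial (Fin n) K),
      ρ (tgen k) P * (X (hi k) - X (lo k)) = P - rename (Equiv.swap (lo k) (hi k)) P)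
    (k : Fin (n - 1)) (f : MvPolynomial (Fin n) K)
    (hf : rename (Equiv.swap (lo k) (hi k)) f = f) : ρ (tgen k) f = 0 := by
  refine mul_right_cancel₀ (X_hi_sub_X_lo_ne_zero k) ?_
  rw [hρt, hf, sub_self, zero_mul]

lemma rep_tgen_X
    (hρt : ∀ (k : Fin (n - 1)) (P : MvPolynomial (Fin n) K),
      ρ (tgen k) P * (X (hi k) - X (lo k)) = P - rename (Equiv.swap (lo k) (hi k)) P)
    (k : Fin (n - 1)) (i : Fin n) :
    ρ (tgen k) (X i) = (if i = hi k then 1 else 0) - (if i = lo k then 1 else 0) := by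
  have hne : lo k ≠ hi k := by simp [lo, hi]
  refine mul_right_cancel₀ (X_hi_sub_X_lo_ne_zero k) ?_
  rw [hρt, rename_X]
  by_cases h₁ : i = hi k
  · subst h₁
    simp [hne.symm]
  · by_cases h₂ : i = lo k
    · subst h₂
      simp [hne]
    · simp [h₁, h₂, Equiv.swap_apply_of_ne_of_ne h₂ h₁]

lemma totalDegree_rep_tgen_le
    (hρt : ∀ (k : Fin (n - 1)) (P : MvPolynomial (Fin n) K),
      ρ (tgen k) P * (X (hi k) - X (lo k)) = P - rename (Equiv.swap (lo k) (hi k)) P)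
    (k : Fin (n - 1)) (f : MvPolynomial (Fin n) K) :
    (ρ (tgen k) f).totalDegree ≤ f.totalDegree - 1 := by
  by_cases h : ρ (tgen k) f = 0
  · simp [h]
  have hd : (X (hi k) - X (lo k) : MvPolynomial (Fin n) K).totalDegree ≠ 0 := by
    intro h0
    have hc := congrArg (coeff (Finsupp.single (hi k) 1)) (totalDegree_eq_zero_iff_eq_C.1 h0)
    have hne : lo k ≠ hi k := by simp [lo, hi]
    simp [coeff_X, Finsupp.single_left_inj, hne] at hc
  have h₁ := totalDegree_mul_of_isDomain h (X_hi_sub_X_lo_ne_zero (K := K) k)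
  have h₂ := totalDegree_sub f (rename (Equiv.swap (lo k) (hi k)) f)
  have h₃ := totalDegree_rename_le (Equiv.swap (lo k) (hi k)) f
  rw [hρt] at h₁
  omega

/-- Moving a polynomial past a generator `τ`. -/
lemma tgen_mul_polynomial (hι : ∀ i, ι (X i) = xgen i)
    (hρt : ∀ (k : Fin (n - 1)) (P : MvPolynomial (Fin n) K),
      ρ (tgen k) P * (X (hi k) - X (lo k)) = P - rename (Equiv.swap (lo k) (hi k)) P)
    (k : Fin (n - 1)) (p : MvPolynomial (Fin n) K) :
    tgen k * ι p = ι (rename (Equiv.swap (lo k) (hi k)) p) * tgen k + ι (ρ (tgen k) p) := by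
  induction p using MvPolynomial.induction_on with
  | C a =>
    rw [rename_C, rep_tgen_eq_zero hρt k _ (rename_C _ _), map_zero, add_zero,
      ← MvPolynomial.algebraMap_eq, AlgHom.commutes]
    exact (Algebra.commutes a _).symm
  | add p q hp hq => simp only [map_add, mul_add, add_mul, hp, hq]; abel
  | mul_X p i hp =>
    rw [rep_tgen_mul hρt, rep_tgen_X hρt, map_mul ι, ← mul_assoc, hp, add_mul, mul_assoc, hι,
      tgen_mul_xgen]
    simp only [map_mul, map_add, map_sub, apply_ite ι, map_one, map_zero, rename_X, hι, mul_add,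
      mul_assoc, add_assoc]

/-- If every `τ` annihilates `y` from the left, then `p ↦ ι p * y` is `H_n`-linear. -/
lemma polynomial_rep_mul (hι : ∀ i, ι (X i) = xgen i)
    (hρx : ∀ (i : Fin n) (P : MvPolynomial (Fin n) K), ρ (xgen i) P = X i * P)
    (hρt : ∀ (k : Fin (n - 1)) (P : MvPolynomial (Fin n) K),
      ρ (tgen k) P * (X (hi k) - X (lo k)) = P - rename (Equiv.swap (lo k) (hi k)) P)
    {y : NilHecke K n} (hy : ∀ k, tgen k * y = 0) (h : NilHecke K n)
    (p : MvPolynomial (Fin n) K) : ι (ρ h p) * y = h * (ι p * y) := by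
  induction h using induction_gen generalizing p with
  | h_scalar r => simp [Algebra.smul_def, mul_assoc]
  | h_xgen i => rw [hρx, map_mul, hι, mul_assoc]
  | h_tgen k =>
    rw [← mul_assoc, tgen_mul_polynomial hι hρt, add_mul, mul_assoc (ι _), hy, mul_zero, zero_add]
  | h_sum a b ha hb => rw [map_add, LinearMap.add_apply, map_add, add_mul, ha, hb, add_mul]
  | h_prod a b ha hb => rw [map_mul, Module.End.mul_apply, ha, hb, mul_assoc]

lemma tauProd_mul_symmetric (hι : ∀ i, ι (X i) = xgen i)
    (hρt : ∀ (k : Fin (n - 1)) (P : MvPolynomial (Fin n) K),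
      ρ (tgen k) P * (X (hi k) - X (lo k)) = P - rename (Equiv.swap (lo k) (hi k)) P)
    (L : List (Fin (n - 1))) {s : MvPolynomial (Fin n) K} (hs : s.IsSymmetric) :
    tauProd L * ι s = ι s * tauProd L := by
  induction L with
  | nil => simp [tauProd]
  | cons k L ih =>
    have hk := tgen_mul_polynomial hι hρt k s
    rw [rep_tgen_eq_zero hρt k s (hs _), hs, map_zero, add_zero] at hk
    rw [tauProd, List.map_cons, List.prod_cons, ← tauProd, mul_assoc, ih, ← mul_assoc, hk,
      mul_assoc]

/-! ### Evaluating the longest Demazure operator -/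

/-- The variable with zero-based index `i` (zero when out of range). -/
noncomputable def xNat (K : Type) [Field K] (n i : ℕ) : MvPolynomial (Fin n) K :=
  if h : i < n then X ⟨i, h⟩ else 0

/-- The evaluation killing all variables of zero-based index larger than `j`. -/
noncomputable def killAbove (K : Type) [Field K] (n j : ℕ) :
    MvPolynomial (Fin n) K →ₐ[K] MvPolynomial (Fin n) K :=
  aeval fun i => if i.val ≤ j then X i else 0

lemma killAbove_rep_tgen
    (hρt : ∀ (k : Fin (n - 1)) (P : MvPolynomial (Fin n) K),
      ρ (tgen k) P * (X (hi k) - X (lo k)) = P - rename (Equiv.swap (lo k) (hi k)) P)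
    (k : Fin (n - 1)) (f : MvPolynomial (Fin n) K)
    (hf : killAbove K n (k + 1) f = X (hi k) ^ (k.val + 1)) :
    killAbove K n k (ρ (tgen k) f) = X (lo k) ^ k.val := by
  have h₁ : killAbove K n k f = killAbove K n k (killAbove K n (k + 1) f) := by
    rw [← AlgHom.comp_apply]
    congr 1
    ext1 i
    simp only [killAbove, AlgHom.comp_apply, aeval_X]
    split_ifs <;> first | omega | simp_all
  have h₂ : killAbove K n k (rename (Equiv.swap (lo k) (hi k)) f) =
      killAbove K n k (rename (Equiv.swap (lo k) (hi k)) (killAbove K n (k + 1) f)) := by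
    rw [← AlgHom.comp_apply, ← AlgHom.comp_apply, ← AlgHom.comp_apply]
    congr 1
    ext1 i
    simp only [killAbove, AlgHom.comp_apply, aeval_X, rename_X]
    by_cases hik : i.val ≤ k.val + 1
    · simp [hik]
    · rw [if_neg hik, Equiv.swap_apply_of_ne_of_ne, if_neg (by omega)]
      · simp
      · simp only [ne_eq, Fin.ext_iff, lo]; omega
      · simp only [ne_eq, Fin.ext_iff, hi]; omega
  have hlo : killAbove K n k (X (lo k)) = X (lo k) := by simp [killAbove, lo]
  have hhi : killAbove K n k (X (hi k)) = 0 := by simp [killAbove, hi]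
  have h := congrArg (killAbove K n k) (hρt k f)
  rw [map_mul, map_sub, map_sub, h₁, h₂, hf, hlo, hhi, map_pow, map_pow, rename_X,
    Equiv.swap_apply_right, map_pow, hlo, hhi, zero_pow (Nat.succ_ne_zero _), zero_sub,
    zero_sub] at h
  refine mul_right_cancel₀ (neg_ne_zero.2 (X_ne_zero (lo k))) (h.trans ?_)
  ring

/-- The operator `∂_0 ∂_1 ⋯ ∂_m` sends `x_{m+1}^{m+1}` to `1` (zero-based indices). -/
lemma rep_run
    (hρt : ∀ (k : Fin (n - 1)) (P : MvPolynomial (Fin n) K),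
      ρ (tgen k) P * (X (hi k) - X (lo k)) = P - rename (Equiv.swap (lo k) (hi k)) P)
    (m : ℕ) (hm : m + 1 < n) :
    ρ ((List.range' 0 (m + 1)).map (tNat K n)).prod (xNat K n (m + 1) ^ (m + 1)) = 1 := by
  have key : ∀ d j, j + d = m + 1 →
      killAbove K n j (ρ ((List.range' j d).map (tNat K n)).prod (xNat K n (m + 1) ^ (m + 1))) =
        xNat K n j ^ j ∧
      (ρ ((List.range' j d).map (tNat K n)).prod
        (xNat K n (m + 1) ^ (m + 1))).totalDegree ≤ j := by
    intro d
    induction d with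
    | zero =>
      rintro j rfl
      simp [xNat, hm, killAbove, totalDegree_X_pow]
    | succ d ih =>
      intro j hj
      obtain ⟨h₁, h₂⟩ := ih (j + 1) (by omega)
      have hj' : j < n - 1 := by omega
      have ht : tNat K n j = tgen ⟨j, hj'⟩ := by simp [tNat, hj']
      rw [List.range'_succ, List.map_cons, List.prod_cons, map_mul, Module.End.mul_apply, ht]
      refine ⟨?_, ?_⟩
      · rw [killAbove_rep_tgen hρt ⟨j, hj'⟩ _ (h₁.trans ?_)]
        · simp [xNat, lo, show j < n by omega]
        · simp [xNat, hi, show j + 1 < n by omega]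
      · have := totalDegree_rep_tgen_le hρt ⟨j, hj'⟩
          (ρ ((List.range' (j + 1) d).map (tNat K n)).prod (xNat K n (m + 1) ^ (m + 1)))
        omega
  obtain ⟨h₁, h₂⟩ := key (m + 1) 0 (by omega)
  rw [totalDegree_eq_zero_iff_eq_C.1 (Nat.le_zero.1 h₂)] at h₁ ⊢
  simpa [killAbove] using h₁

lemma rep_prod_tNat_mul
    (hρt : ∀ (k : Fin (n - 1)) (P : MvPolynomial (Fin n) K),
      ρ (tgen k) P * (X (hi k) - X (lo k)) = P - rename (Equiv.swap (lo k) (hi k)) P)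
    (L : List ℕ) {m : ℕ} (hL : ∀ k ∈ L, k < m) (a : ℕ) (f : MvPolynomial (Fin n) K) :
    ρ (L.map (tNat K n)).prod (f * xNat K n (m + 1) ^ a) =
      ρ (L.map (tNat K n)).prod f * xNat K n (m + 1) ^ a := by
  induction L with
  | nil => simp
  | cons k L ih =>
    rw [List.map_cons, List.prod_cons, map_mul ρ, Module.End.mul_apply, Module.End.mul_apply,
      ih fun x hx => hL x (by simp [hx])]
    have hkm := hL k (by simp)
    by_cases hk : k < n - 1
    · have hs : rename (Equiv.swap (lo ⟨k, hk⟩) (hi ⟨k, hk⟩)) (xNat K n (m + 1) ^ a) =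
          xNat K n (m + 1) ^ a := by
        unfold xNat
        split_ifs with h
        · rw [map_pow, rename_X, Equiv.swap_apply_of_ne_of_ne] <;>
            simp only [ne_eq, Fin.ext_iff, lo, hi] <;> omega
        · simp
      have ht : tNat K n k = tgen ⟨k, hk⟩ := by simp [tNat, hk]
      rw [ht, mul_comm, rep_tgen_mul hρt, rep_tgen_eq_zero hρt _ _ hs, hs, zero_mul, add_zero,
        mul_comm]
    · simp [tNat, hk]

lemma lt_of_mem_maxWord {m k : ℕ} (h : k ∈ maxWord m) : k < m := by
  induction m with
  | zero => simp [maxWord] at h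
  | succ m ih =>
    rcases List.mem_append.1 h with h | h
    · rw [List.mem_range'_1] at h
      omega
    · exact (ih h).trans (Nat.lt_succ_self m)

lemma rep_maxWord
    (hρt : ∀ (k : Fin (n - 1)) (P : MvPolynomial (Fin n) K),
      ρ (tgen k) P * (X (hi k) - X (lo k)) = P - rename (Equiv.swap (lo k) (hi k)) P)
    (m : ℕ) (hm : m < n) :
    ρ ((maxWord m).map (tNat K n)).prod (∏ i ∈ Finset.range (m + 1), xNat K n i ^ i) = 1 := by
  induction m with
  | zero => simp [maxWord]
  | succ m ih =>
    rw [Finset.prod_range_succ, maxWord, List.map_append, List.prod_append, map_mul ρ,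
      Module.End.mul_apply, rep_prod_tNat_mul hρt _ fun k hk => lt_of_mem_maxWord hk,
      ih (by omega), one_mul, rep_run hρt m hm]

end Rep

end NilHecke

/-- The map `P_n → H_n e_n`, `p ↦ ι(p)·τ_{ω₀}`, sending `1` to
`τ_{ω₀}`, is an isomorphism of `(H_n, P_n^{S_n})`-bimodules onto the left ideal
`H_n e_n`, where `e_n = x_2 x_3² ⋯ x_n^{n-1} τ_{ω₀}`, `H_n` acts on `P_n` via the
polynomial representation `ρ` (with `x_k` acting by multiplication and `τ_k` by the
Demazure operator `∂_k`), and `P_n^{S_n}` acts by (right) multiplication on both sides.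
`τ_{ω₀}` is encoded by any reduced word `L₀` for the longest element of `S_n`, and
`ι` is the embedding of the polynomial subalgebra of `H_n` (`ι(X i) = x_i`). -/
theorem nilHecke_ideal_iso_polynomial_rep (K : Type) [Field K] (n : ℕ)
    (L₀ : List (Fin (n - 1)))
    (hL₀len : L₀.length = n * (n - 1) / 2)
    (hL₀red : invCount (wordProd L₀) = L₀.length)
    (ι : MvPolynomial (Fin n) K →ₐ[K] NilHecke K n)
    (hι : ∀ i, ι (MvPolynomial.X i) = xgen i)
    (ρ : NilHecke K n →ₐ[K] Module.End K (MvPolynomial (Fin n) K))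
    (hρx : ∀ (i : Fin n) (P : MvPolynomial (Fin n) K), ρ (xgen i) P = MvPolynomial.X i * P)
    (hρt : ∀ (k : Fin (n - 1)) (P : MvPolynomial (Fin n) K),
      ρ (tgen k) P * (MvPolynomial.X (NHGen.hi k) - MvPolynomial.X (NHGen.lo k)) =
        P - MvPolynomial.rename (Equiv.swap (NHGen.lo k) (NHGen.hi k)) P) :
    (Function.Injective (fun p : MvPolynomial (Fin n) K => ι p * tauProd L₀)) ∧
    (Set.range (fun p : MvPolynomial (Fin n) K => ι p * tauProd L₀) =
      {y : NilHecke K n | ∃ h : NilHecke K n,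
        y = h * (ι (∏ i : Fin n, MvPolynomial.X i ^ i.val) * tauProd L₀)}) ∧
    (∀ (h : NilHecke K n) (p : MvPolynomial (Fin n) K),
      ι (ρ h p) * tauProd L₀ = h * (ι p * tauProd L₀)) ∧
    (∀ (p s : MvPolynomial (Fin n) K), s ∈ MvPolynomial.symmetricSubalgebra (Fin n) K →
      ι (p * s) * tauProd L₀ = (ι p * tauProd L₀) * ι s) ∧
    ι (1 : MvPolynomial (Fin n) K) * tauProd L₀ = tauProd L₀ := by
  have hmax : L₀.length = (maxWord (n - 1)).length := by
    rw [hL₀len, length_maxWord]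
    rcases n with _ | n <;> rfl
  have hlt : ∀ k ∈ L₀.map Fin.val, k < n - 1 := by simp
  have hkill (k : Fin (n - 1)) : tgen k * (tauProd L₀ : NilHecke K n) = 0 := by
    have h := NilHecke.prod_tNat_eq_zero K (n := n) ((k :: L₀).map Fin.val) (by simp)
      (by simp [hmax])
    rwa [← NilHecke.tauProd_eq_map_val] at h
  have hone : ρ (tauProd L₀) (∏ i : Fin n, MvPolynomial.X i ^ i.val) = 1 := by
    rw [NilHecke.tauProd_eq_map_val, NilHecke.prod_tNat_eq_maxWord K _ hlt (by simpa using hmax)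
      (by rw [← NilHecke.wordProd_eq_map_val, hL₀red, List.length_map])]
    rcases n with _ | n
    · simp [maxWord]
    · rw [← NilHecke.rep_maxWord hρt n (Nat.lt_succ_self n), Finset.prod_range]
      simp [NilHecke.xNat, Fin.is_le]
  have hlin := NilHecke.polynomial_rep_mul hι hρx hρt hkill
  have hρι (p q : MvPolynomial (Fin n) K) : ρ (ι p) q = p * q := by
    induction p using MvPolynomial.induction_on generalizing q with
    | C a => simp [← MvPolynomial.algebraMap_eq, Algebra.smul_def]
    | add p₁ p₂ h₁ h₂ => simp [add_mul, h₁, h₂]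
    | mul_X p i h => rw [map_mul, map_mul, Module.End.mul_apply, h, hι, hρx, mul_assoc]
  refine ⟨fun p q hpq => ?_, Set.ext fun y => ⟨?_, ?_⟩, hlin, fun p s hs => ?_, by simp⟩
  · have h := congrArg (fun y => ρ y (∏ i : Fin n, MvPolynomial.X i ^ i.val)) hpq
    simpa [hone, hρι] using h
  · rintro ⟨p, rfl⟩
    refine ⟨ι p * tauProd L₀, ?_⟩
    simp only [← hlin, map_mul, Module.End.mul_apply, hone, hρι, mul_one]
  · rintro ⟨h, rfl⟩
    exact ⟨_, hlin h _⟩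
  · rw [map_mul, mul_assoc, mul_assoc, NilHecke.tauProd_mul_symmetric hι hρt L₀
      ((MvPolynomial.mem_symmetricSubalgebra s).1 hs)]
end
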